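/- For every ε > 0 and every integer p' ≥ 1/(26·ε²), the polynomial Ṗ_relu^(p')(α) := 1/2 + (1/π)·Σ_{i=0}^{p'} (2i)!·α^{2i+1} / (2^{2i}·(i!)²·(2i+1)) satisfies sup_{α∈[−1,1]} |Ṗ_relu^(p')(α) − κ0(α)| ≤ ε. -/

import Mathlib

noncomputable def kappa0 (α : ℝ) : ℝ := (1 / Real.pi) * (Real.pi - Real.arccos α)

/-- the truncated Taylor polynomial `Ṗ_relu^(p')` approximating `κ0`. -/
noncomputable def PdotRelu (p : ℕ) (α : ℝ) : ℝ :=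
  1 / 2 +
    (1 / Real.pi) * ∑ i ∈ Finset.range (p + 1),
      (Nat.factorial (2 * i) : ℝ) * α ^ (2 * i + 1) /
        (2 ^ (2 * i) * ((Nat.factorial i : ℝ)) ^ 2 * (2 * i + 1))

noncomputable def cc (i : ℕ) : ℝ :=
  (Nat.factorial (2 * i) : ℝ) / (2 ^ (2 * i) * ((Nat.factorial i : ℝ)) ^ 2)

noncomputable def SS (p : ℕ) (x : ℝ) : ℝ :=
  ∑ i ∈ Finset.range (p + 1), cc i / (2 * i + 1) * x ^ (2 * i + 1)

noncomputable def TT (p : ℕ) (x : ℝ) : ℝ :=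
  ∑ i ∈ Finset.range (p + 1), cc i * x ^ (2 * i)

lemma cc_zero : cc 0 = 1 := by simp [cc]

lemma cc_pos (i : ℕ) : 0 < cc i := by unfold cc; positivity

lemma cc_succ (i : ℕ) : cc (i + 1) * (2 * i + 2) = (2 * i + 1) * cc i := by
  unfold cc
  have h : 2 * (i + 1) = (2 * i + 1) + 1 := by ring
  rw [h, Nat.factorial_succ, Nat.factorial_succ, Nat.factorial_succ]
  have := Nat.factorial_pos i
  push_cast
  field_simp
  ring

lemma cc_sq (i : ℕ) : cc (i + 1) ^ 2 * (i + 1 + 1 / 2) ≤ 3 / 8 := by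
  induction i with
  | zero =>
    have h := cc_succ 0
    rw [cc_zero] at h
    norm_num at h
    have : cc 1 = 1 / 2 := by linarith
    norm_num [this]
  | succ n ih =>
    have h := cc_succ (n + 1)
    push_cast at h ⊢
    have hn : (0 : ℝ) ≤ n := Nat.cast_nonneg n
    have h2 : cc (n + 1 + 1) = (2 * (n + 1) + 1) * cc (n + 1) / (2 * (n + 1) + 2) := by
      field_simp
      linarith
    refine le_trans ?_ ih
    rw [h2, div_pow, mul_pow, div_mul_eq_mul_div, div_le_iff₀ (by positivity)]
    have := sq_nonneg (cc (n + 1))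
    have key : (2 * ((n : ℝ) + 1) + 1) ^ 2 * (n + 1 + 1 + 1 / 2)
        ≤ (n + 1 + 1 / 2) * (2 * (n + 1) + 2) ^ 2 := by nlinarith
    nlinarith [mul_le_mul_of_nonneg_left key this]

lemma hasDeriv_S (p : ℕ) (x : ℝ) : HasDerivAt (SS p) (TT p x) x := by
  unfold SS TT
  apply HasDerivAt.fun_sum
  intro i _
  have h := (hasDerivAt_pow (2 * i + 1) x).const_mul (cc i / (2 * i + 1))
  refine h.congr_deriv ?_
  push_cast
  field_simp

noncomputable def DD (p : ℕ) (θ : ℝ) : ℝ := Real.cos θ * TT p (Real.sin θ)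

lemma hasDeriv_D (p : ℕ) (θ : ℝ) :
    HasDerivAt (DD p) (-((2 * p + 1) * cc p * Real.sin θ ^ (2 * p + 1))) θ := by
  induction p with
  | zero =>
    have : DD 0 = Real.cos := by
      funext t; simp [DD, TT, cc_zero]
    rw [this]
    convert Real.hasDerivAt_cos θ using 1
    simp [cc_zero]
  | succ n ih =>
    have e : DD (n + 1) = fun t => DD n t +
        cc (n + 1) * (Real.cos t * Real.sin t ^ (2 * n + 2)) := by
      funext t
      unfold DD TT
      rw [Finset.sum_range_succ _ (n + 1)]
      ring
    rw [e]
    have h := ih.add (((Real.hasDerivAt_cos θ).mul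
      ((Real.hasDerivAt_sin θ).pow (2 * n + 2))).const_mul (cc (n + 1)))
    refine h.congr_deriv ?_
    have hc := cc_succ n
    have hs : Real.cos θ ^ 2 = 1 - Real.sin θ ^ 2 := by
      linarith [Real.sin_sq_add_cos_sq θ]
    have e1 : 2 * n + 2 - 1 = 2 * n + 1 := by omega
    rw [e1]
    push_cast
    simp only [Pi.pow_apply]
    linear_combination (Real.sin θ ^ (2 * n + 1)) * hc
      + cc (n + 1) * (2 * n + 2) * Real.sin θ ^ (2 * n + 1) * hs

lemma D_zero (p : ℕ) : DD p 0 = 1 := by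
  unfold DD TT
  rw [Finset.sum_range_succ']
  simp [cc_zero]

lemma S_zero (p : ℕ) : SS p 0 = 0 := by
  unfold SS
  simp

lemma D_le (p : ℕ) {θ : ℝ} (h0 : 0 ≤ θ) (h1 : θ ≤ Real.pi / 2) : DD p θ ≤ 1 := by
  have : AntitoneOn (DD p) (Set.Icc 0 (Real.pi / 2)) := by
    apply antitoneOn_of_deriv_nonpos (convex_Icc _ _)
    · exact fun x _ => (hasDeriv_D p x).continuousAt.continuousWithinAt
    · exact fun x _ => (hasDeriv_D p x).differentiableAt.differentiableWithinAt
    · intro x hx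
      rw [interior_Icc] at hx
      rw [(hasDeriv_D p x).deriv]
      have := Real.sin_nonneg_of_nonneg_of_le_pi hx.1.le (by linarith [hx.2, Real.pi_pos])
      have := cc_pos p
      have : 0 ≤ (2 * p + 1) * cc p * Real.sin x ^ (2 * p + 1) := by positivity
      linarith
  rw [← D_zero p]
  exact this ⟨le_rfl, by positivity⟩ ⟨h0, h1⟩ h0

lemma hasDeriv_E (p : ℕ) (θ : ℝ) :
    HasDerivAt (fun t => t - SS p (Real.sin t)) (1 - DD p θ) θ := by
  have h := (hasDerivAt_id θ).sub
    ((hasDeriv_S p (Real.sin θ)).comp θ (Real.hasDerivAt_sin θ))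
  refine h.congr_deriv ?_
  unfold DD
  ring

lemma E_mono (p : ℕ) :
    MonotoneOn (fun t => t - SS p (Real.sin t)) (Set.Icc 0 (Real.pi / 2)) := by
  apply monotoneOn_of_deriv_nonneg (convex_Icc _ _)
  · exact fun x _ => (hasDeriv_E p x).continuousAt.continuousWithinAt
  · exact fun x _ => (hasDeriv_E p x).differentiableAt.differentiableWithinAt
  · intro x hx
    rw [interior_Icc] at hx
    rw [(hasDeriv_E p x).deriv]
    linarith [D_le p hx.1.le hx.2.le]

lemma hasDeriv_H (p : ℕ) (θ : ℝ) :
    HasDerivAt (fun t => (t - SS p (Real.sin t)) + (Real.pi / 2 - t) * (1 - DD p t)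
      - cc p * Real.sin t ^ (2 * p + 1))
      ((2 * p + 1) * cc p * Real.sin θ ^ (2 * p) *
        ((Real.pi / 2 - θ) * Real.sin θ - Real.cos θ)) θ := by
  have h := ((hasDeriv_E p θ).add (((hasDerivAt_id θ).const_sub (Real.pi / 2)).mul
    ((hasDeriv_D p θ).const_sub 1))).sub
    (((Real.hasDerivAt_sin θ).pow (2 * p + 1)).const_mul (cc p))
  refine h.congr_deriv ?_
  simp only [id, Nat.add_sub_cancel]
  push_cast
  ring

lemma E_end (p : ℕ) : Real.pi / 2 - SS p 1 ≤ cc p := by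
  have : AntitoneOn (fun t => (t - SS p (Real.sin t)) + (Real.pi / 2 - t) * (1 - DD p t)
      - cc p * Real.sin t ^ (2 * p + 1)) (Set.Icc 0 (Real.pi / 2)) := by
    apply antitoneOn_of_deriv_nonpos (convex_Icc _ _)
    · exact fun x _ => (hasDeriv_H p x).continuousAt.continuousWithinAt
    · exact fun x _ => (hasDeriv_H p x).differentiableAt.differentiableWithinAt
    · intro x hx
      rw [interior_Icc] at hx
      rw [(hasDeriv_H p x).deriv]
      have hs := Real.sin_pos_of_pos_of_lt_pi hx.1 (by linarith [hx.2, Real.pi_pos])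
      have hc := cc_pos p
      have ht := Real.lt_tan (x := Real.pi / 2 - x) (by linarith [hx.2]) (by linarith [hx.1])
      rw [Real.tan_eq_sin_div_cos, Real.sin_pi_div_two_sub, Real.cos_pi_div_two_sub,
        lt_div_iff₀ hs] at ht
      apply mul_nonpos_of_nonneg_of_nonpos
      · positivity
      · linarith
  have hp : (0 : ℝ) ≤ Real.pi / 2 := by positivity
  have h := this ⟨le_rfl, hp⟩ ⟨hp, le_rfl⟩ hp
  simp [D_zero, S_zero] at h
  linarith

lemma bound_pos (p : ℕ) {x : ℝ} (h0 : 0 ≤ x) (h1 : x ≤ 1) :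
    |SS p x - Real.arcsin x| ≤ cc p := by
  have hp : (0 : ℝ) ≤ Real.pi / 2 := by positivity
  have ha := Real.arcsin_nonneg.2 h0
  have hb := Real.arcsin_le_pi_div_two x
  have l := E_mono p ⟨le_rfl, hp⟩ ⟨ha, hb⟩ ha
  have u := E_mono p ⟨ha, hb⟩ ⟨hp, le_rfl⟩ hb
  simp only [Real.sin_zero, S_zero, Real.sin_pi_div_two,
    Real.sin_arcsin (by linarith : -1 ≤ x) h1] at l u
  have := E_end p
  rw [abs_le]
  constructor <;> linarith [cc_pos p]

lemma S_neg (p : ℕ) (x : ℝ) : SS p (-x) = - SS p x := by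
  unfold SS
  rw [← Finset.sum_neg_distrib]
  refine Finset.sum_congr rfl fun i _ => ?_
  rw [Odd.neg_pow ⟨i, rfl⟩]
  ring

lemma bound_all (p : ℕ) {x : ℝ} (h0 : -1 ≤ x) (h1 : x ≤ 1) :
    |SS p x - Real.arcsin x| ≤ cc p := by
  rcases le_total 0 x with h | h
  · exact bound_pos p h h1
  · have := bound_pos p (x := -x) (by linarith) (by linarith)
    rw [S_neg, Real.arcsin_neg, ← abs_neg] at this
    convert this using 2
    ring

theorem pdotrelu_approx_kappa0 (ε : ℝ) (hε : 0 < ε) (p' : ℕ)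
    (hp : 1 / (26 * ε ^ 2) ≤ (p' : ℝ)) :
    ∀ α ∈ Set.Icc (-1 : ℝ) 1, |PdotRelu p' α - kappa0 α| ≤ ε := by
  intro α hα
  have hS : PdotRelu p' α - kappa0 α = (SS p' α - Real.arcsin α) / Real.pi := by
    have : ∑ i ∈ Finset.range (p' + 1), (Nat.factorial (2 * i) : ℝ) * α ^ (2 * i + 1) /
        (2 ^ (2 * i) * ((Nat.factorial i : ℝ)) ^ 2 * (2 * i + 1)) = SS p' α := by
      unfold SS cc
      refine Finset.sum_congr rfl fun i _ => ?_
      field_simp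
    unfold PdotRelu kappa0
    rw [this, Real.arccos_eq_pi_div_two_sub_arcsin]
    field_simp
    ring
  rw [hS, abs_div, abs_of_pos Real.pi_pos, div_le_iff₀ Real.pi_pos]
  refine (bound_all p' hα.1 hα.2).trans ?_
  have hpos : (0 : ℝ) < p' := lt_of_lt_of_le (by positivity) hp
  rw [div_le_iff₀ (by positivity)] at hp
  obtain ⟨n, rfl⟩ : ∃ n, p' = n + 1 :=
    Nat.exists_eq_succ_of_ne_zero (by rintro rfl; simp at hpos)
  have hc := cc_sq n
  have hq : cc (n + 1) ^ 2 * ((n + 1 : ℕ) : ℝ) ≤ 3 / 8 := by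
    push_cast
    nlinarith [sq_nonneg (cc (n + 1))]
  have h3 : cc (n + 1) ^ 2 ≤ 39 / 4 * ε ^ 2 := by
    have h4 := mul_le_mul_of_nonneg_left hp (sq_nonneg (cc (n + 1)))
    have h5 := mul_le_mul_of_nonneg_right hq (by positivity : 0 ≤ 26 * ε ^ 2)
    nlinarith
  refine (sq_le_sq₀ (cc_pos _).le (by positivity)).1 ?_
  have := Real.pi_gt_d2
  have : (39 / 4 : ℝ) ≤ Real.pi ^ 2 := by nlinarith
  rw [mul_pow]
  nlinarith [sq_nonneg ε]
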